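/- Let q ≥ 1 and n₁,…,n_q be positive integers, and let P be the polynomial ring over 𝔽₂ = ℤ/2 in the indeterminates β_i^{(p)} for 1 ≤ p ≤ q and 1 ≤ i ≤ ⌊n_p/2⌋. With the conventions β_0^{(p)} := 1, β_i^{(p)} := β_{n_p−i}^{(p)} for ⌊n_p/2⌋ < i ≤ n_p, and β_i^{(p)} := 0 for i < 0 or i > n_p, define for m ∈ ℤ the elements μ_m := Σ_{a₁+⋯+a_q = m} β_{a₁}^{(1)}⋯β_{a_q}^{(q)} ∈ P and μ̃_m := μ_m + (binom(n₁+⋯+n_q, m) mod 2). Set h := ⌊n₁/2⌋ + ⋯ + ⌊n_q/2⌋. Then μ₁, μ₂,…, μ_h is a P-regular sequence, and likewise μ̃₁, μ̃₂,…, μ̃_h is a P-regular sequence. -/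

import Mathlib

open MvPolynomial

/-- A sequence (given as a list) `a₁, …, aₙ` in a commutative ring `A` is `A`-regular if for
each `i`, `aᵢ` is not a zero divisor on `A ⧸ (a₁, …, a_{i-1})`. -/
def IsRegularSeq {A : Type*} [CommRing A] (l : List A) : Prop :=
  ∀ (i : ℕ) (h : i < l.length), ∀ x : A,
    l.get ⟨i, h⟩ * x ∈ Ideal.span {y | y ∈ l.take i} →
      x ∈ Ideal.span {y | y ∈ l.take i}

/-- The element `β_i^{(p)}` of the polynomial ring `P` over `𝔽₂` in the indeterminates
`β_i^{(p)}`, `1 ≤ p ≤ q`, `1 ≤ i ≤ ⌊n_p/2⌋`, with the conventions `β_0^{(p)} = 1`,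
`β_i^{(p)} = β_{n_p−i}^{(p)}` for `⌊n_p/2⌋ < i ≤ n_p`, and `β_i^{(p)} = 0` for `i > n_p`. -/
noncomputable def bb (q : ℕ) (n : Fin q → ℕ) (p : Fin q) (i : ℕ) :
    MvPolynomial (Σ p : Fin q, Fin (n p / 2)) (ZMod 2) :=
  if h : i ≤ n p then
    (if h1 : 1 ≤ min i (n p - i) then X ⟨p, ⟨min i (n p - i) - 1, by omega⟩⟩ else 1)
  else 0

/-- `μ_m := Σ_{a₁+⋯+a_q = m} β_{a₁}^{(1)} ⋯ β_{a_q}^{(q)}`. -/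
noncomputable def muP (q : ℕ) (n : Fin q → ℕ) (m : ℕ) :
    MvPolynomial (Σ p : Fin q, Fin (n p / 2)) (ZMod 2) :=
  ∑ a ∈ (Fintype.piFinset fun _ : Fin q => Finset.range (m + 1)).filter
      (fun a => ∑ p, a p = m),
    ∏ p, bb q n p (a p)

/-- `μ̃_m := μ_m + (binom(n₁+⋯+n_q, m) mod 2)`. -/
noncomputable def muTildeP (q : ℕ) (n : Fin q → ℕ) (m : ℕ) :
    MvPolynomial (Σ p : Fin q, Fin (n p / 2)) (ZMod 2) :=
  muP q n m + (Nat.choose (∑ p, n p) m : MvPolynomial (Σ p : Fin q, Fin (n p / 2)) (ZMod 2))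

theorem RingHom.Flat.of_comp_faithfullyFlat {A B C : Type*} [CommRing A] [CommRing B] [CommRing C]
    {f : A →+* B} {g : B →+* C} (hg : g.FaithfullyFlat) (hgf : (g.comp f).Flat) : f.Flat := by
  algebraize [f, g, g.comp f]
  have : Module.FaithfullyFlat B C := hg
  have : Module.Flat A C := hgf
  change Module.Flat A B
  rw [Module.Flat.iff_lTensor_preserves_injective_linearMap]
  intro N P _ _ _ _ l hl
  have h := TensorProduct.AlgebraTensorModule.lTensor_comp_cancelBaseChange A B C (M := C) l
  have key := (Module.FaithfullyFlat.lTensor_injective_iff_injective B C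
    (TensorProduct.AlgebraTensorModule.lTensor B B l)).mp ?_
  · exact key
  have h1 : Function.Injective (LinearMap.lTensor C l) :=
    Module.Flat.lTensor_preserves_injective_linearMap l hl
  have h2 : Function.Injective (TensorProduct.AlgebraTensorModule.lTensor C C l ∘ₗ
      (TensorProduct.AlgebraTensorModule.cancelBaseChange A B C C N).toLinearMap) := by
    rw [LinearMap.coe_comp]
    exact Function.Injective.comp h1
      (TensorProduct.AlgebraTensorModule.cancelBaseChange A B C C N).injective
  rw [h, LinearMap.coe_comp] at h2
  exact h2.of_comp

theorem Polynomial.flat_mapRingHom {R S : Type*} [CommRing R] [CommRing S] {f : R →+* S}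
    (hf : f.Flat) : (Polynomial.mapRingHom f).Flat := by
  algebraize [f]
  let : Algebra (Polynomial R) (Polynomial S) := Polynomial.algebra R S
  have h : Algebra.IsPushout R (Polynomial R) S (Polynomial S) := inferInstance
  have := Module.Flat.isBaseChange R (Polynomial R) S (Polynomial S) h.out
  exact RingHom.flat_algebraMap_iff.mpr this

namespace MvPolynomial

/-- The ring homomorphism that sends the indeterminates of `MvPolynomial (Fin n) A` to the lowest
`n` coefficients of `G`. -/
noncomputable def coeffHom {A B : Type*} [CommRing A] [CommRing B] (f : A →+* B) (n : ℕ)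
    (G : Polynomial B) : MvPolynomial (Fin n) A →+* B :=
  eval₂Hom f fun i => G.coeff i

section coeffHom

variable {A B C : Type*} [CommRing A] [CommRing B] [CommRing C]

theorem coeffHom_comp_C (f : A →+* B) (n : ℕ) (G : Polynomial B) :
    (coeffHom f n G).comp MvPolynomial.C = f := by
  ext; simp [coeffHom]

theorem comp_coeffHom (g : B →+* C) (f : A →+* B) (n : ℕ) (G : Polynomial B) :
    g.comp (coeffHom f n G) = coeffHom (g.comp f) n (G.map g) := by
  ext <;> simp [coeffHom]

theorem map_coeffHom_freeMonic (f : A →+* B) {n : ℕ} {G : Polynomial B} (hG : G.Monic)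
    (hn : G.natDegree = n) : (Polynomial.freeMonic A n).map (coeffHom f n G) = G := by
  ext i
  rw [Polynomial.coeff_map, Polynomial.coeff_freeMonic]
  split_ifs with h1 h2
  · simp [coeffHom]
  · rw [h2, ← hn, hG.coeff_natDegree, map_one]
  · rw [map_zero, Polynomial.coeff_eq_zero_of_natDegree_lt]
    omega

theorem ringHom_ext_freeMonic {n : ℕ} {φ ψ : MvPolynomial (Fin n) A →+* B}
    (hC : φ.comp MvPolynomial.C = ψ.comp MvPolynomial.C)
    (h : (Polynomial.freeMonic A n).map φ = (Polynomial.freeMonic A n).map ψ) : φ = ψ := by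
  refine ringHom_ext (fun r => RingHom.congr_fun hC r) fun i => ?_
  simpa [Polynomial.coeff_freeMonic] using congrArg (Polynomial.coeff · i) h

end coeffHom

section linearFactor

variable (A : Type*) [CommRing A] [Nontrivial A] (n : ℕ)

/-- The product of a monic linear polynomial with free constant coefficient and of a free monic
polynomial of degree `n`. -/
noncomputable def linearMulFreeMonic : Polynomial (MvPolynomial (Fin n) (Polynomial A)) :=
  (Polynomial.X - Polynomial.C (C Polynomial.X)) * Polynomial.freeMonic (Polynomial A) n

omit [Nontrivial A] in
theorem monic_linearMulFreeMonic : (linearMulFreeMonic A n).Monic :=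
  (Polynomial.monic_X_sub_C _).mul (Polynomial.monic_freeMonic _ _)

theorem natDegree_linearMulFreeMonic : (linearMulFreeMonic A n).natDegree = n + 1 := by
  rw [linearMulFreeMonic, (Polynomial.monic_X_sub_C _).natDegree_mul
    (Polynomial.monic_freeMonic _ _), Polynomial.natDegree_X_sub_C,
    Polynomial.natDegree_freeMonic, add_comm]

/-- The ring homomorphism splitting off a linear factor of the free monic polynomial of
degree `n + 1`. -/
noncomputable def splitLinear :
    MvPolynomial (Fin (n + 1)) A →+* MvPolynomial (Fin n) (Polynomial A) :=
  coeffHom (C.comp Polynomial.C) (n + 1) (linearMulFreeMonic A n)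

omit [Nontrivial A] in
theorem splitLinear_comp_C : (splitLinear A n).comp C = C.comp Polynomial.C :=
  coeffHom_comp_C _ _ _

theorem map_splitLinear_freeMonic :
    (Polynomial.freeMonic A (n + 1)).map (splitLinear A n) = linearMulFreeMonic A n :=
  map_coeffHom_freeMonic _ (monic_linearMulFreeMonic A n) (natDegree_linearMulFreeMonic A n)

theorem faithfullyFlat_splitLinear : (splitLinear A n).FaithfullyFlat := by
  set F := Polynomial.freeMonic A (n + 1) with hF
  have hFm : F.Monic := Polynomial.monic_freeMonic _ _
  have hψ := map_splitLinear_freeMonic A n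
  have h0 : F.eval₂ (splitLinear A n) (C Polynomial.X) = 0 := by
    rw [← Polynomial.eval_map, hψ, linearMulFreeMonic]
    simp
  set e := AdjoinRoot.lift (splitLinear A n) (C Polynomial.X) h0
  have : Nontrivial (AdjoinRoot F) := e.domain_nontrivial
  set r := AdjoinRoot.root F with hr
  set Q := (F.map (AdjoinRoot.of F)) /ₘ (Polynomial.X - Polynomial.C r) with hQ
  have hQmul : (Polynomial.X - Polynomial.C r) * Q = F.map (AdjoinRoot.of F) := by
    rw [hQ, Polynomial.mul_divByMonic_eq_iff_isRoot, Polynomial.IsRoot, Polynomial.eval_map]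
    exact AdjoinRoot.eval₂_root F
  have hQm : Q.Monic := (Polynomial.monic_X_sub_C r).of_mul_monic_left (hQmul ▸ hFm.map _)
  have hQd : Q.natDegree = n := by
    have := congrArg Polynomial.natDegree hQmul
    rw [(Polynomial.monic_X_sub_C r).natDegree_mul hQm, Polynomial.natDegree_X_sub_C,
      hFm.natDegree_map, Polynomial.natDegree_freeMonic] at this
    omega
  set ι : Polynomial A →+* AdjoinRoot F :=
    Polynomial.eval₂RingHom ((AdjoinRoot.of F).comp C) r with hι
  have heof : e.comp (AdjoinRoot.of F) = splitLinear A n := AdjoinRoot.lift_comp_of h0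
  have her : e r = C Polynomial.X := AdjoinRoot.lift_root h0
  set e' := coeffHom ι n Q with he'
  have he'X : e' (C Polynomial.X) = r := by simp [he', coeffHom, hι]
  have he'C : e'.comp C = ι := coeffHom_comp_C _ _ _
  have he'F : (Polynomial.freeMonic (Polynomial A) n).map e' = Q := map_coeffHom_freeMonic _ hQm hQd
  have h1 : e'.comp (splitLinear A n) = AdjoinRoot.of F := by
    refine ringHom_ext_freeMonic ?_ ?_
    · rw [RingHom.comp_assoc, splitLinear_comp_C, ← RingHom.comp_assoc, he'C]
      ext; simp [hι]
    · rw [← Polynomial.map_map, hψ, linearMulFreeMonic, Polynomial.map_mul, he'F,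
        Polynomial.map_sub, Polynomial.map_X, Polynomial.map_C, he'X, hQmul]
  have h2 : e'.comp e = RingHom.id _ := by
    refine AdjoinRoot.ringHom_ext ?_ ?_
    · rw [RingHom.comp_assoc, heof, h1, RingHom.id_comp]
    · simp [← hr, her, he'X]
  have h3 : e.comp e' = RingHom.id _ := by
    refine ringHom_ext_freeMonic ?_ ?_
    · rw [RingHom.comp_assoc, he'C, RingHom.id_comp]
      refine Polynomial.ringHom_ext' ?_ ?_
      · rw [← splitLinear_comp_C, ← heof]
        ext; simp [hι]
      · simp [hι, her]
    · rw [← Polynomial.map_map, he'F, Polynomial.map_id]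
      refine (Polynomial.monic_X_sub_C (C Polynomial.X)).isRegular.left ?_
      change _ * _ = linearMulFreeMonic A n
      rw [← hψ, ← heof, ← Polynomial.map_map, ← hQmul, Polynomial.map_mul, Polynomial.map_sub,
        Polynomial.map_X, Polynomial.map_C, her]
  have hbij : Function.Bijective e := by
    refine Function.bijective_iff_has_inverse.mpr ⟨e', fun x => ?_, fun x => ?_⟩
    · exact RingHom.congr_fun h2 x
    · exact RingHom.congr_fun h3 x
  have hfree : Module.Free (MvPolynomial (Fin (n + 1)) A) (AdjoinRoot F) := hFm.free_adjoinRoot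
  have hof : (AdjoinRoot.of F).FaithfullyFlat :=
    RingHom.faithfullyFlat_algebraMap_iff.mpr inferInstance
  rw [← heof]
  exact RingHom.FaithfullyFlat.stableUnderComposition _ _ hof (.of_bijective hbij)

end linearFactor

/-- Multivariate polynomials with polynomial coefficients are the same as polynomials with
multivariate polynomial coefficients. -/
theorem bijective_eval₂Hom_mapRingHom_C (A : Type*) [CommRing A] (σ : Type*) :
    Function.Bijective (eval₂Hom (Polynomial.mapRingHom (C : A →+* MvPolynomial σ A))
      fun i => Polynomial.C (X i)) := by
  set φ := eval₂Hom (Polynomial.mapRingHom (C : A →+* MvPolynomial σ A))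
      fun i => Polynomial.C (X i) with hφ
  set ψ : Polynomial (MvPolynomial σ A) →+* MvPolynomial σ (Polynomial A) :=
    Polynomial.eval₂RingHom (map Polynomial.C) (C Polynomial.X) with hψ
  have h1 : φ.comp ψ = RingHom.id _ := by
    refine Polynomial.ringHom_ext' (ringHom_ext ?_ ?_) ?_ <;> simp [hφ, hψ]
  have h2 : ψ.comp φ = RingHom.id _ := by
    refine ringHom_ext' (Polynomial.ringHom_ext ?_ ?_) ?_ <;> simp [hφ, hψ]
  exact Function.bijective_iff_has_inverse.mpr
    ⟨ψ, RingHom.congr_fun h2, RingHom.congr_fun h1⟩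

theorem flat_coeffHom_mapRingHom {A B : Type*} [CommRing A] [CommRing B] {f : A →+* B} {n : ℕ}
    {G : Polynomial B} (h : (coeffHom f n G).Flat) :
    (coeffHom (Polynomial.mapRingHom f) n (G.map Polynomial.C)).Flat := by
  have : coeffHom (Polynomial.mapRingHom f) n (G.map Polynomial.C) =
      (Polynomial.mapRingHom (coeffHom f n G)).comp
        (eval₂Hom (Polynomial.mapRingHom (C : A →+* MvPolynomial (Fin n) A))
          fun i => Polynomial.C (X i)) := by
    refine ringHom_ext' (Polynomial.ringHom_ext ?_ ?_) ?_ <;> simp [coeffHom]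
  rw [this]
  exact (RingHom.Flat.of_bijective (bijective_eval₂Hom_mapRingHom_C A (Fin n))).comp
    (Polynomial.flat_mapRingHom h)

/-- If the coefficients of a monic polynomial `G` define a flat morphism, then so do those of the
product of `G` with a free monic polynomial. -/
theorem flat_coeffHom_mul_freeMonic {A : Type*} {B : Type*} [CommRing A] [CommRing B]
    [Nontrivial A] [Nontrivial B] {f : A →+* B} {k : ℕ}
    {G : Polynomial B} (hG : G.Monic) (hGk : G.natDegree = k) (h : (coeffHom f k G).Flat) (m : ℕ) :
    (coeffHom (C.comp f) (k + m) (G.map C * Polynomial.freeMonic B m)).Flat := by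
  induction m generalizing A B with
  | zero =>
    have : coeffHom (C.comp f) (k + 0) (G.map C * Polynomial.freeMonic B 0) =
        (C : B →+* MvPolynomial (Fin 0) B).comp (coeffHom f k G) := by
      rw [comp_coeffHom]
      simp [Polynomial.freeMonic]
    rw [this]
    exact h.comp (RingHom.Flat.of_bijective ⟨C_injective (Fin 0) B, C_surjective (Fin 0)⟩)
  | succ m ih =>
    have key : (splitLinear B m).comp
          (coeffHom (C.comp f) (k + (m + 1)) (G.map C * Polynomial.freeMonic B (m + 1))) =
        (coeffHom (C.comp (Polynomial.mapRingHom f)) (k + m)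
          ((G.map Polynomial.C).map C * Polynomial.freeMonic (Polynomial B) m)).comp
          (splitLinear A (k + m)) := by
      have hd : ((G.map Polynomial.C).map C * Polynomial.freeMonic (Polynomial B) m).natDegree =
          k + m := by
        rw [((hG.map _).map _).natDegree_mul (Polynomial.monic_freeMonic _ _),
          (hG.map _).natDegree_map, hG.natDegree_map, hGk, Polynomial.natDegree_freeMonic]
      have hm : ((G.map Polynomial.C).map C * Polynomial.freeMonic (Polynomial B) m).Monic :=
        ((hG.map _).map _).mul (Polynomial.monic_freeMonic _ _)
      rw [comp_coeffHom, splitLinear.eq_def A, comp_coeffHom]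
      congr 1
      · rw [← RingHom.comp_assoc, splitLinear_comp_C, ← RingHom.comp_assoc, coeffHom_comp_C]
        ext; simp
      · rw [Polynomial.map_mul, map_splitLinear_freeMonic, linearMulFreeMonic,
          linearMulFreeMonic, Polynomial.map_mul, map_coeffHom_freeMonic _ hm hd,
          Polynomial.map_map, Polynomial.map_map, splitLinear_comp_C]
        simp [coeffHom]
        ring
    refine RingHom.Flat.of_comp_faithfullyFlat (faithfullyFlat_splitLinear B m) ?_
    rw [key]
    exact (faithfullyFlat_splitLinear A (k + m)).flat.comp
      (ih (hG.map _) (by rw [hG.natDegree_map, hGk]) (flat_coeffHom_mapRingHom h))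

/-- The free monic polynomial of degree `m p`, over the polynomial ring in the coefficients of
such polynomials for all `p`. -/
noncomputable def blockPoly (k : Type*) [CommRing k] {q : ℕ} (m : Fin q → ℕ) (p : Fin q) :
    Polynomial (MvPolynomial (Σ p : Fin q, Fin (m p)) k) :=
  (Polynomial.freeMonic k (m p)).map (rename (Sigma.mk p)).toRingHom

section blockPoly

variable {k : Type*} [CommRing k] {q : ℕ}

theorem monic_blockPoly (m : Fin q → ℕ) (p : Fin q) : (blockPoly k m p).Monic :=
  (Polynomial.monic_freeMonic _ _).map _

theorem coeff_blockPoly (m : Fin q → ℕ) (p : Fin q) (i : Fin (m p)) :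
    (blockPoly k m p).coeff i = X ⟨p, i⟩ := by
  simp [blockPoly, Polynomial.coeff_freeMonic]

variable [Nontrivial k]

theorem natDegree_blockPoly (m : Fin q → ℕ) (p : Fin q) : (blockPoly k m p).natDegree = m p := by
  rw [blockPoly, (Polynomial.monic_freeMonic _ _).natDegree_map, Polynomial.natDegree_freeMonic]

omit [Nontrivial k] in
theorem monic_prod_blockPoly (m : Fin q → ℕ) : (∏ p, blockPoly k m p).Monic :=
  Polynomial.monic_prod_of_monic _ _ fun p _ => monic_blockPoly m p

theorem natDegree_prod_blockPoly (m : Fin q → ℕ) :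
    (∏ p, blockPoly k m p).natDegree = ∑ p, m p := by
  rw [Polynomial.natDegree_prod_of_monic _ _ fun p _ => monic_blockPoly m p]
  simp [natDegree_blockPoly]

omit [Nontrivial k] in
theorem bijective_eval₂Hom_rename_castSucc (m : Fin (q + 1) → ℕ) :
    Function.Bijective (eval₂Hom
      (rename (R := k) fun x : Σ p : Fin q, Fin (m p.castSucc) =>
        (⟨x.1.castSucc, x.2⟩ : Σ p, Fin (m p))).toRingHom
      fun i : Fin (m (Fin.last q)) => X ⟨Fin.last q, i⟩) := by
  set φ := eval₂Hom (rename (R := k) fun x : Σ p : Fin q, Fin (m p.castSucc) =>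
        (⟨x.1.castSucc, x.2⟩ : Σ p, Fin (m p))).toRingHom
      fun i : Fin (m (Fin.last q)) => X ⟨Fin.last q, i⟩ with hφ
  let v (p : Fin (q + 1)) : Fin (m p) →
      MvPolynomial (Fin (m (Fin.last q))) (MvPolynomial (Σ p : Fin q, Fin (m p.castSucc)) k) :=
    Fin.lastCases (fun i => X i) (fun p i => C (X ⟨p, i⟩)) p
  set ψ := eval₂Hom (C.comp (C : k →+* MvPolynomial (Σ p : Fin q, Fin (m p.castSucc)) k))
    (fun x : Σ p, Fin (m p) => v x.1 x.2) with hψ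
  have h1 : φ.comp ψ = RingHom.id _ := by
    refine ringHom_ext (by simp [hφ, hψ]) ?_
    rintro ⟨p, i⟩
    induction p using Fin.lastCases <;> simp [hφ, hψ, v]
  have h2 : ψ.comp φ = RingHom.id _ := by
    refine ringHom_ext' (ringHom_ext ?_ ?_) ?_ <;> simp [hφ, hψ, v]
  exact Function.bijective_iff_has_inverse.mpr
    ⟨ψ, RingHom.congr_fun h2, RingHom.congr_fun h1⟩

/-- The multiplication of monic polynomials defines a flat morphism. -/
theorem flat_coeffHom_prod_blockPoly (m : Fin q → ℕ) (h : ℕ) (hh : h = ∑ p, m p) :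
    (coeffHom C h (∏ p, blockPoly k m p)).Flat := by
  induction q generalizing h with
  | zero =>
    obtain rfl : h = 0 := by simpa using hh
    have : (coeffHom C 0 (∏ p, blockPoly k m p)).comp (C : k →+* MvPolynomial (Fin 0) k) = C :=
      coeffHom_comp_C _ _ _
    rw [← RingHom.Flat.comp_iff_of_bijective_right ⟨C_injective (Fin 0) k, C_surjective (Fin 0)⟩,
      this]
    exact RingHom.Flat.of_bijective ⟨C_injective _ k, C_surjective _⟩
  | succ q ih =>
    set m' : Fin q → ℕ := fun p => m p.castSucc with hm'
    have h1 := flat_coeffHom_mul_freeMonic (monic_prod_blockPoly (k := k) m')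
      (natDegree_prod_blockPoly m') (ih m' _ rfl) (m (Fin.last q))
    have h2 := h1.comp (RingHom.Flat.of_bijective (bijective_eval₂Hom_rename_castSucc (k := k) m))
    rw [Fin.sum_univ_castSucc] at hh
    subst hh
    convert h2 using 1
    rw [comp_coeffHom]
    congr 1
    · ext; simp
    · rw [Polynomial.map_mul, Fin.prod_univ_castSucc, Polynomial.map_map, Polynomial.map_prod]
      congr 1
      · refine Finset.prod_congr rfl fun p _ => ?_
        rw [blockPoly, blockPoly, Polynomial.map_map]
        congr 1
        ext <;> simp
      · rw [blockPoly, ← Polynomial.map_map_freeMonic _ _ _ C, Polynomial.map_map]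
        congr 1
        ext <;> simp

end blockPoly

end MvPolynomial

namespace Polynomial

theorem coeff_prod_univ {R ι : Type*} [CommSemiring R] [Fintype ι] [DecidableEq ι]
    (f : ι → Polynomial R) (d : ℕ) :
    (∏ p, f p).coeff d = ∑ a ∈ (Fintype.piFinset fun _ : ι => Finset.range (d + 1)).filter
      (fun a => ∑ p, a p = d), ∏ p, (f p).coeff (a p) := by
  rw [← Polynomial.coeff_coe, ← Polynomial.coeToPowerSeries.ringHom_apply, map_prod,
    PowerSeries.coeff_prod]
  refine Finset.sum_bij' (fun a _ => ⇑a) (fun a _ => Finsupp.equivFunOnFinite.symm a) ?_ ?_ ?_ ?_ ?_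
  · intro a ha
    rw [Finset.mem_finsuppAntidiag] at ha
    simp only [Finset.mem_filter, Fintype.mem_piFinset, Finset.mem_range]
    refine ⟨fun i => ?_, ha.1⟩
    have := Finset.single_le_sum (f := a) (fun _ _ => Nat.zero_le _) (Finset.mem_univ i)
    rw [ha.1] at this
    omega
  · intro a ha
    rw [Finset.mem_filter] at ha
    simpa using ha.2
  · intro a _
    ext; simp
  · intro a _
    ext; simp
  · intro a _
    simp

section palindromic

variable {R S : Type*} [CommRing R] [CommRing S]

/-- The palindromic polynomial `(1 + X) ^ K * ∑ g_i * (1 + X) ^ (2 * i) * X ^ (m - i)`, where `g_i`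
are the coefficients of a polynomial `g` of degree at most `m`. -/
noncomputable def palindromic (K m : ℕ) (g : Polynomial R) : Polynomial R :=
  (1 + X) ^ K * (g.homogenize m).eval₂ C ![(1 + X) ^ 2, X]

theorem coeff_palindromic (K m : ℕ) (g : Polynomial R) (j : ℕ) :
    (palindromic K m g).coeff j = ∑ x ∈ Finset.HasAntidiagonal.antidiagonal m,
      if x.2 ≤ j then g.coeff x.1 * ((K + 2 * x.1).choose (j - x.2) : R) else 0 := by
  have : palindromic K m g = ∑ x ∈ Finset.HasAntidiagonal.antidiagonal m,
      C (g.coeff x.1) * (1 + X) ^ (K + 2 * x.1) * X ^ x.2 := by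
    rw [palindromic, homogenize, MvPolynomial.eval₂_sum, Finset.mul_sum]
    refine Finset.sum_congr rfl fun x _ => ?_
    rw [MvPolynomial.eval₂_monomial]
    simp [pow_add, pow_mul]
    ring
  rw [this, finsetSum_coeff]
  refine Finset.sum_congr rfl fun x _ => ?_
  rw [coeff_mul_X_pow']
  simp [coeff_one_add_X_pow]

theorem map_palindromic (f : R →+* S) (K m : ℕ) (g : Polynomial R) :
    (palindromic K m g).map f = palindromic K m (g.map f) := by
  ext j
  simp only [coeff_map, coeff_palindromic, map_sum]
  refine Finset.sum_congr rfl fun x _ => ?_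
  split_ifs <;> simp

theorem palindromic_prod {ι : Type*} (s : Finset ι) (K m : ι → ℕ) (g : ι → Polynomial R)
    (hg : ∀ p ∈ s, (g p).natDegree ≤ m p) :
    palindromic (∑ p ∈ s, K p) (∑ p ∈ s, m p) (∏ p ∈ s, g p) =
      ∏ p ∈ s, palindromic (K p) (m p) (g p) := by
  simp only [palindromic]
  rw [Finset.prod_mul_distrib, Finset.prod_pow_eq_pow_sum, homogenize_finsetProd hg,
    MvPolynomial.eval₂_prod]

theorem coeff_palindromic_zero (K m : ℕ) (g : Polynomial R) :
    (palindromic K m g).coeff 0 = g.coeff m := by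
  rw [coeff_palindromic, Finset.sum_eq_single (m, 0)]
  · simp
  · rintro ⟨a, b⟩ hx hne
    rw [if_neg]
    simp only [Finset.HasAntidiagonal.mem_antidiagonal, ne_eq, Prod.mk.injEq] at hx hne ⊢
    omega
  · simp

theorem coeff_palindromic_of_lt {K m j : ℕ} (g : Polynomial R) (hj : 2 * m + K < j) :
    (palindromic K m g).coeff j = 0 := by
  rw [coeff_palindromic]
  refine Finset.sum_eq_zero fun x hx => ?_
  rw [Finset.HasAntidiagonal.mem_antidiagonal] at hx
  rw [Nat.choose_eq_zero_of_lt (by omega)]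
  simp

theorem coeff_palindromic_symm {K m j : ℕ} (g : Polynomial R) (hj : j ≤ 2 * m + K) :
    (palindromic K m g).coeff (2 * m + K - j) = (palindromic K m g).coeff j := by
  rw [coeff_palindromic, coeff_palindromic]
  refine Finset.sum_congr rfl fun x hx => ?_
  rw [Finset.HasAntidiagonal.mem_antidiagonal] at hx
  split_ifs with h1 h2 h2
  · rw [← Nat.choose_symm_of_eq_add (show K + 2 * x.1 = (j - x.2) + (2 * m + K - j - x.2) by omega)]
  · rw [Nat.choose_eq_zero_of_lt (by omega)]
    simp
  · rw [Nat.choose_eq_zero_of_lt (by omega)]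
    simp
  · rfl

/-- The coefficients of `g` can be recovered from those of `palindromic K m g`. -/
theorem coeff_mem_of_coeff_palindromic_mem {K m : ℕ} {g : Polynomial R} (A : Subring R)
    (h : ∀ j ≤ m, (palindromic K m g).coeff j ∈ A) {i : ℕ} (hi : i ≤ m) : g.coeff i ∈ A := by
  suffices H : ∀ j ≤ m, g.coeff (m - j) ∈ A by
    simpa [Nat.sub_sub_self hi] using H (m - i) (Nat.sub_le _ _)
  intro j
  induction j using Nat.strong_induction_on with
  | _ j ih =>
    intro hj
    have hmem : (m - j, j) ∈ Finset.HasAntidiagonal.antidiagonal m := by simp; omega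
    have h1 := h j hj
    rw [coeff_palindromic, ← Finset.add_sum_erase _ _ hmem] at h1
    simp only [le_refl, if_true, Nat.sub_self, Nat.choose_zero_right, Nat.cast_one, mul_one] at h1
    refine (A.add_mem_cancel_right (A.sum_mem ?_)).mp h1
    rintro ⟨a, b⟩ hx
    simp only [Finset.mem_erase, ne_eq, Prod.mk.injEq, Finset.HasAntidiagonal.mem_antidiagonal] at hx
    split_ifs with hb
    · obtain rfl : a = m - b := by omega
      exact A.mul_mem (ih b (by omega) (by omega)) (natCast_mem A _)
    · exact A.zero_mem

end palindromic

end Polynomial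

theorem RingHom.injective_of_surjective_of_isNoetherianRing {R : Type*} [CommRing R]
    [IsNoetherianRing R] {f : R →+* R} (hf : Function.Surjective f) : Function.Injective f := by
  let I : ℕ →o Ideal R := ⟨fun n => RingHom.ker (f ^ n), monotone_nat_of_le_succ fun n x hx => by
    rw [RingHom.mem_ker] at hx ⊢
    rw [pow_succ', RingHom.mul_def, RingHom.comp_apply, hx, map_zero]⟩
  obtain ⟨n, hn⟩ := monotone_stabilizes_iff_noetherian.mpr ‹IsNoetherianRing R› I
  rw [injective_iff_map_eq_zero]
  intro x hx
  obtain ⟨y, rfl⟩ := hf.iterate n x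
  have h1 : y ∈ I (n + 1) := by
    change (f ^ (n + 1)) y = 0
    rw [RingHom.coe_pow, Function.iterate_succ_apply', hx]
  rw [← hn (n + 1) (Nat.le_succ n)] at h1
  rw [← RingHom.coe_pow]
  exact h1

theorem isRegularSeq_iff_isWeaklyRegular {A : Type*} [CommRing A] (l : List A) :
    IsRegularSeq l ↔ RingTheory.Sequence.IsWeaklyRegular A l := by
  rw [RingTheory.Sequence.isWeaklyRegular_iff]
  refine forall₂_congr fun i hi => ?_
  rw [isSMulRegular_quotient_iff_mem_of_smul_mem]
  simp [Ideal.ofList]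

theorem IsRegularSeq.map_of_flat {A B : Type*} [CommRing A] [CommRing B] {l : List A}
    (hl : IsRegularSeq l) {f : A →+* B} (hf : f.Flat) : IsRegularSeq (l.map f) := by
  algebraize [f]
  rw [isRegularSeq_iff_isWeaklyRegular] at hl ⊢
  exact hl.of_flat

namespace MvPolynomial

theorem mem_span_X_image_of_X_mul_mem {σ R : Type*} [CommRing R] {s : Set σ} {i : σ} (hi : i ∉ s)
    {x : MvPolynomial σ R} (hx : X i * x ∈ Ideal.span (X '' s : Set (MvPolynomial σ R))) :
    x ∈ Ideal.span (X '' s : Set (MvPolynomial σ R)) := by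
  rw [mem_ideal_span_X_image] at hx ⊢
  intro m hm
  obtain ⟨j, hj, hne⟩ := hx (Finsupp.single i 1 + m) (by
    rw [mem_support_iff] at hm ⊢
    rwa [coeff_X_mul])
  refine ⟨j, hj, ?_⟩
  have hij : i ≠ j := fun h => hi (h ▸ hj)
  simpa [Finsupp.single_apply, hij] using hne

theorem isRegularSeq_X (R : Type*) [CommRing R] (h : ℕ) :
    IsRegularSeq ((List.finRange h).map (X : Fin h → MvPolynomial (Fin h) R)) := by
  intro i hi x
  have hs : {y | y ∈ ((List.finRange h).map (X : Fin h → MvPolynomial (Fin h) R)).take i} =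
      X '' {j : Fin h | j ∈ (List.finRange h).take i} := by
    ext y
    simp [← List.map_take]
  rw [hs]
  have hi' : i < h := by simpa using hi
  have : (⟨i, hi'⟩ : Fin h) ∉ {j : Fin h | j ∈ (List.finRange h).take i} := by
    simp only [Set.mem_ofPred_eq, List.mem_take_iff_getElem]
    rintro ⟨j, hj, hj'⟩
    have := congrArg Fin.val hj'
    simp at this
    omega
  simpa using mem_span_X_image_of_X_mul_mem this (x := x)

end MvPolynomial

section main

variable (q : ℕ) (n : Fin q → ℕ)

/-- The change of variables that turns the palindromic polynomials with coefficients `bb q n p`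
into those associated with free monic polynomials. -/
noncomputable def palindromicHom : MvPolynomial (Σ p : Fin q, Fin (n p / 2)) (ZMod 2) →+*
    MvPolynomial (Σ p : Fin q, Fin (n p / 2)) (ZMod 2) :=
  eval₂Hom C fun x => (Polynomial.palindromic (n x.1 % 2) (n x.1 / 2)
    (blockPoly (ZMod 2) (fun p => n p / 2) x.1)).coeff (x.2 + 1)

theorem palindromicHom_bb (p : Fin q) (j : ℕ) :
    palindromicHom q n (bb q n p j) = (Polynomial.palindromic (n p % 2) (n p / 2)
      (blockPoly (ZMod 2) (fun p => n p / 2) p)).coeff j := by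
  have hn : n p = 2 * (n p / 2) + n p % 2 := (Nat.div_add_mod _ _).symm
  set G := Polynomial.palindromic (n p % 2) (n p / 2) (blockPoly (ZMod 2) (fun p => n p / 2) p)
    with hG
  have h0 : G.coeff 0 = 1 := by
    rw [hG, Polynomial.coeff_palindromic_zero,
      ← (monic_blockPoly (k := ZMod 2) (fun p => n p / 2) p).coeff_natDegree, natDegree_blockPoly]
  by_cases h : j ≤ n p
  · have hmin : G.coeff (min j (n p - j)) = G.coeff j := by
      rcases min_choice j (n p - j) with h' | h' <;> rw [h']
      have := Polynomial.coeff_palindromic_symm (K := n p % 2) (m := n p / 2) (j := j)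
        (blockPoly (ZMod 2) (fun p => n p / 2) p) (by omega)
      rwa [← hn] at this
    rw [bb, dif_pos h, ← hmin]
    split_ifs with h1
    · simp [palindromicHom, ← hG, Nat.sub_add_cancel h1]
    · rw [map_one, ← h0]
      congr 1
      omega
  · rw [bb, dif_neg h, map_zero, hG, Polynomial.coeff_palindromic_of_lt _ (by omega)]

theorem palindromicHom_muP (j : ℕ) :
    palindromicHom q n (muP q n j) = (Polynomial.palindromic (∑ p, n p % 2) (∑ p, n p / 2)
      (∏ p, blockPoly (ZMod 2) (fun p => n p / 2) p)).coeff j := by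
  rw [Polynomial.palindromic_prod _ _ _ _ fun p _ => (natDegree_blockPoly _ p).le,
    Polynomial.coeff_prod_univ, muP, map_sum]
  refine Finset.sum_congr rfl fun a _ => ?_
  rw [map_prod]
  exact Finset.prod_congr rfl fun p _ => palindromicHom_bb q n p _

theorem bijective_palindromicHom : Function.Bijective (palindromicHom q n) := by
  have hsurj : Function.Surjective (palindromicHom q n) := by
    rw [← RingHom.range_eq_top, eq_top_iff]
    rintro x -
    induction x using MvPolynomial.induction_on with
    | C a => exact ⟨C a, by simp [palindromicHom]⟩
    | add x y hx hy => exact add_mem hx hy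
    | mul_X x i hx =>
      refine mul_mem hx ?_
      rw [← coeff_blockPoly (k := ZMod 2) (fun p => n p / 2) i.1 i.2]
      exact Polynomial.coeff_mem_of_coeff_palindromic_mem (K := n i.1 % 2) (m := n i.1 / 2)
        (palindromicHom q n).range
        (fun j _ => ⟨bb q n i.1 j, palindromicHom_bb q n i.1 j⟩) i.2.2.le
  exact ⟨RingHom.injective_of_surjective_of_isNoetherianRing hsurj, hsurj⟩

/-- The triangular affine change of variables given by the coefficients of the palindromic
polynomial associated with a free monic polynomial of degree `h`. -/
noncomputable def palindromicAffineHom (K h : ℕ) (c : ℕ → ZMod 2) :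
    MvPolynomial (Fin h) (ZMod 2) →+* MvPolynomial (Fin h) (ZMod 2) :=
  eval₂Hom C fun i =>
    (Polynomial.palindromic K h (Polynomial.freeMonic (ZMod 2) h)).coeff (i + 1) + C (c i)

theorem bijective_palindromicAffineHom (K h : ℕ) (c : ℕ → ZMod 2) :
    Function.Bijective (palindromicAffineHom K h c) := by
  have hC (a) : C a ∈ (palindromicAffineHom K h c).range := ⟨C a, by simp [palindromicAffineHom]⟩
  have hsurj : Function.Surjective (palindromicAffineHom K h c) := by
    rw [← RingHom.range_eq_top, eq_top_iff]
    rintro x -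
    induction x using MvPolynomial.induction_on with
    | C a => exact hC a
    | add x y hx hy => exact add_mem hx hy
    | mul_X x i hx =>
      refine mul_mem hx ?_
      have hi : (Polynomial.freeMonic (ZMod 2) h).coeff i = X i := by
        simp [Polynomial.coeff_freeMonic]
      rw [← hi]
      refine Polynomial.coeff_mem_of_coeff_palindromic_mem (K := K) (m := h)
        (palindromicAffineHom K h c).range
        (fun j hj => ?_) i.2.le
      rcases j with _ | j
      · rw [Polynomial.coeff_palindromic_zero, Polynomial.coeff_freeMonic]
        simp
      · refine (add_mem_cancel_right (hC (c j))).mp ⟨X ⟨j, hj⟩, ?_⟩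
        simp [palindromicAffineHom]
  exact ⟨RingHom.injective_of_surjective_of_isNoetherianRing hsurj, hsurj⟩

theorem isRegularSeq_muP_add_C (c : ℕ → ZMod 2) :
    IsRegularSeq ((List.range (∑ p, n p / 2)).map fun i => muP q n (i + 1) + C (c i)) := by
  set h := ∑ p, n p / 2 with hh
  set Φ : MvPolynomial (Fin h) (ZMod 2) →+* MvPolynomial (Σ p : Fin q, Fin (n p / 2)) (ZMod 2) :=
    eval₂Hom C fun i => muP q n (i + 1) + C (c i) with hΦ
  set φ := coeffHom (C : ZMod 2 →+* MvPolynomial (Σ p : Fin q, Fin (n p / 2)) (ZMod 2)) h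
    (∏ p, blockPoly (ZMod 2) (fun p => n p / 2) p) with hφ
  have hcomp : (palindromicHom q n).comp Φ =
      φ.comp (palindromicAffineHom (∑ p, n p % 2) h c) := by
    refine ringHom_ext (fun r => ?_) fun i => ?_
    · simp [hΦ, hφ, palindromicHom, palindromicAffineHom, coeffHom]
    · have h1 : φ (C (c i)) = C (c i) := by simp [hφ, coeffHom]
      have h2 : palindromicHom q n (C (c i)) = C (c i) := by simp [palindromicHom]
      have h3 : (Polynomial.freeMonic (ZMod 2) h).map φ =
          ∏ p, blockPoly (ZMod 2) (fun p => n p / 2) p :=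
        map_coeffHom_freeMonic _ (monic_prod_blockPoly _) (natDegree_prod_blockPoly _)
      simp only [hΦ, palindromicAffineHom, RingHom.comp_apply, eval₂Hom_X', map_add, h1, h2,
        palindromicHom_muP]
      rw [← Polynomial.coeff_map, Polynomial.map_palindromic, h3]
  have hflat : Φ.Flat := by
    rw [← RingHom.Flat.comp_iff_of_bijective_left (bijective_palindromicHom q n), hcomp]
    exact (RingHom.Flat.of_bijective (bijective_palindromicAffineHom _ _ _)).comp
      (flat_coeffHom_prod_blockPoly _ _ hh)
  convert (isRegularSeq_X (ZMod 2) h).map_of_flat hflat using 1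
  refine List.ext_getElem (by simp) fun i _ _ => ?_
  simp [hΦ]

end main

/-- `μ₁, …, μ_h` and `μ̃₁, …, μ̃_h` are `P`-regular sequences, `h = ⌊n₁/2⌋ + ⋯ + ⌊n_q/2⌋`. -/
theorem stmt_9 (q : ℕ) (hq : 1 ≤ q) (n : Fin q → ℕ) (hn : ∀ p, 1 ≤ n p) :
    IsRegularSeq ((List.range (∑ p, n p / 2)).map fun i => muP q n (i + 1)) ∧
    IsRegularSeq ((List.range (∑ p, n p / 2)).map fun i => muTildeP q n (i + 1)) := by
  constructor
  · simpa using isRegularSeq_muP_add_C q n 0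
  · simpa [muTildeP] using
      isRegularSeq_muP_add_C q n fun i => ((∑ p, n p).choose (i + 1) : ZMod 2)
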